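/- arXiv:math/0510421 — 8 statements merged into one kernel-verified Lean document; each statement's English description precedes it below -/
import Mathlib

section
/- Let f, g : B → A be (not necessarily unital) additive multiplicative maps. The modulations of f and g are isomorphic — that is, there exists an additive bijection Φ from A·g(1_B) onto A·f(1_B) satisfying Φ(a·y) = a·Φ(y) and Φ(y·g(b)) = Φ(y)·f(b) for all a ∈ A, y ∈ A·g(1_B), b ∈ B — if and only if there exist φ ∈ A·f(1_B) and ψ ∈ A·g(1_B) such that φ·ψ = g(1_B), ψ·φ = f(1_B), g(b) = φ·f(b)·ψ for all b ∈ B, and in addition for every x ∈ A: x·φ·ψ = 0 implies x·φ = 0, and x·ψ·φ = 0 implies x·ψ = 0. -/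
/-- Lemma (conjugate, nonunital version): for additive multiplicative maps `f g : B → A`
(not necessarily unital), the modulations (the principal left ideals `A·f(1)` and `A·g(1)`
with right `B`-action via `f`, `g`) are isomorphic iff there are `φ ∈ A·f(1)`, `ψ ∈ A·g(1)`
with `φψ = g(1)`, `ψφ = f(1)`, `g = φ f ψ`, and the two cancellation conditions. -/
theorem modulations_iso_iff_conjugate_nonunital {A B : Type*} [Ring A] [Ring B] (f g : B → A)
    (hf_add : ∀ x y : B, f (x + y) = f x + f y) (hf_mul : ∀ x y : B, f (x * y) = f x * f y)
    (hg_add : ∀ x y : B, g (x + y) = g x + g y) (hg_mul : ∀ x y : B, g (x * y) = g x * g y) :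
    (∃ Φ : A → A,
      Set.BijOn Φ {y : A | ∃ x : A, y = x * g 1} {y : A | ∃ x : A, y = x * f 1} ∧
      (∀ y y' : A, (∃ x, y = x * g 1) → (∃ x, y' = x * g 1) → Φ (y + y') = Φ y + Φ y') ∧
      (∀ (a y : A), (∃ x, y = x * g 1) → Φ (a * y) = a * Φ y) ∧
      (∀ y : A, (∃ x, y = x * g 1) → ∀ b : B, Φ (y * g b) = Φ y * f b)) ↔
    (∃ φ ψ : A, (∃ x : A, φ = x * f 1) ∧ (∃ x : A, ψ = x * g 1) ∧
      φ * ψ = g 1 ∧ ψ * φ = f 1 ∧ (∀ b : B, g b = φ * f b * ψ) ∧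
      (∀ x : A, x * φ * ψ = 0 → x * φ = 0) ∧ (∀ x : A, x * ψ * φ = 0 → x * ψ = 0)) := by
  have f1 : ∀ b, f b * f 1 = f b := fun b => by rw [← hf_mul, mul_one]
  have g1 : ∀ b, g b * g 1 = g b := fun b => by rw [← hg_mul, mul_one]
  have g1' : ∀ b, g 1 * g b = g b := fun b => by rw [← hg_mul, one_mul]
  constructor
  · rintro ⟨Φ, ⟨hmaps, hinj, hsurj⟩, -, hl, hr⟩
    have e1 : ∃ x, g 1 = x * g 1 := ⟨1, by rw [one_mul]⟩
    obtain ⟨p, hp⟩ : ∃ x, Φ (g 1) = x * f 1 := hmaps e1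
    obtain ⟨ψ, ⟨q, hq⟩, hψ⟩ := hsurj (show f 1 ∈ {y : A | ∃ x : A, y = x * f 1} from ⟨1, by rw [one_mul]⟩)
    have key : ∀ x, Φ (x * g 1) = x * Φ (g 1) := fun x => hl x _ e1
    have hψg : ψ * g 1 = ψ := by rw [hq, mul_assoc, g1]
    have hφf : Φ (g 1) * f 1 = Φ (g 1) := by rw [hp, mul_assoc, f1]
    have hψφ : ψ * Φ (g 1) = f 1 := by rw [← key, hψg, hψ]
    have hφψ : Φ (g 1) * ψ = g 1 := by
      apply hinj (⟨Φ (g 1) * ψ, by rw [mul_assoc, hψg]⟩) e1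
      rw [hl _ _ ⟨q, hq⟩, hψ, hφf]
    refine ⟨Φ (g 1), ψ, ⟨p, hp⟩, ⟨q, hq⟩, hφψ, hψφ, ?_, ?_, ?_⟩
    · intro b
      apply hinj ⟨g b, (g1 b).symm⟩ ⟨Φ (g 1) * f b * ψ, by rw [mul_assoc _ ψ, hψg]⟩
      rw [hl _ _ ⟨q, hq⟩, hψ, mul_assoc, f1, ← hr _ e1, g1']
    · intro x h
      rw [← hφf, ← hψφ, ← mul_assoc, ← mul_assoc, h, zero_mul]
    · intro x h
      rw [← hψg, ← hφψ, ← mul_assoc, ← mul_assoc, h, zero_mul]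
  · rintro ⟨φ, ψ, ⟨p, hp⟩, ⟨q, hq⟩, h1, h2, h3, -, -⟩
    refine ⟨fun y => y * φ, ⟨?_, ?_, ?_⟩, fun y y' _ _ => add_mul _ _ _,
      fun a y _ => mul_assoc _ _ _, ?_⟩
    · intro y _
      exact ⟨y * p, by simp only [hp, mul_assoc]⟩
    · rintro y ⟨x, rfl⟩ y' ⟨x', rfl⟩ h
      have h' := congrArg (· * ψ) h
      simpa only [mul_assoc, h1, g1] using h'
    · rintro z ⟨x, rfl⟩
      refine ⟨x * f 1 * ψ, ⟨x * f 1 * q, by simp only [hq, mul_assoc]⟩, ?_⟩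
      simp only [mul_assoc, h2, f1]
    · intro y _ b
      simp only [h3 b, mul_assoc, h2, f1]
end

section
/- For every a ∈ A, the element 1 ⊗ a − S(a) ⊗ 1 of A ⊗_k A lies in the left ideal W. -/
open TensorProduct

theorem aux_comul {k A : Type*} [CommRing k] [Ring A] [HopfAlgebra k A] (a : A) :
    ∑ i ∈ (Coalgebra.Repr.arbitrary k a).index,
      ((HopfAlgebra.antipode k ((Coalgebra.Repr.arbitrary k a).left i)) ⊗ₜ[k] (1 : A)) *
        Coalgebra.comul (R := k) ((Coalgebra.Repr.arbitrary k a).right i) = (1 : A) ⊗ₜ[k] a := by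
  set r := Coalgebra.Repr.arbitrary k a with hr
  have h := Coalgebra.sum_tmul_tmul_eq r (fun i => Coalgebra.Repr.arbitrary k (r.left i))
    (fun i => Coalgebra.Repr.arbitrary k (r.right i))
  have h2 := congrArg (fun x => (LinearMap.mul' k A).rTensor A
    ((TensorProduct.assoc k A A A).symm ((HopfAlgebra.antipode k).rTensor (A ⊗[k] A) x))) h
  simp only [map_sum, LinearMap.rTensor_tmul, TensorProduct.assoc_symm_tmul,
    LinearMap.mul'_apply] at h2
  have e : ∀ i, (HopfAlgebra.antipode k (r.left i) ⊗ₜ[k] (1 : A)) *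
      Coalgebra.comul (R := k) (r.right i) =
      ∑ j ∈ (Coalgebra.Repr.arbitrary k (r.right i)).index,
        (HopfAlgebra.antipode k (r.left i) *
          (Coalgebra.Repr.arbitrary k (r.right i)).left j) ⊗ₜ[k]
          (Coalgebra.Repr.arbitrary k (r.right i)).right j := by
    intro i
    conv_lhs => rw [← (Coalgebra.Repr.arbitrary k (r.right i)).eq]
    simp only [Finset.mul_sum, Algebra.TensorProduct.tmul_mul_tmul, one_mul]
  simp only [e]
  rw [← h2]
  simp only [← TensorProduct.sum_tmul, HopfAlgebra.sum_antipode_mul_eq_smul,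
    TensorProduct.smul_tmul]
  rw [← TensorProduct.tmul_sum, Coalgebra.sum_counit_smul]

/-- For a Hopf algebra `A` with antipode `S`, for every `a ∈ A` the element
`1 ⊗ a − S(a) ⊗ 1` lies in the left ideal `W` of `A ⊗ A` generated by
`{ε(b)·(1⊗1) − Δ(b) : b ∈ A}`. -/
theorem one_tmul_sub_antipode_tmul_one_mem_W
    {k A : Type*} [CommRing k] [Ring A] [HopfAlgebra k A] (a : A) :
    (1 : A) ⊗ₜ[k] a - (HopfAlgebra.antipode (R := k) a) ⊗ₜ[k] (1 : A) ∈
      Submodule.span (A ⊗[k] A)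
        {w : A ⊗[k] A | ∃ b : A,
          w = algebraMap k (A ⊗[k] A) (Coalgebra.counit b) - Coalgebra.comul b} := by
  have h := aux_comul (k := k) a
  set r := Coalgebra.Repr.arbitrary k a with hr
  have h1 : ∑ i ∈ r.index, (HopfAlgebra.antipode k (r.left i) ⊗ₜ[k] (1 : A)) *
      algebraMap k (A ⊗[k] A) (Coalgebra.counit (r.right i)) =
      HopfAlgebra.antipode k a ⊗ₜ[k] (1 : A) := by
    have h3 := congrArg (fun x => (HopfAlgebra.antipode k).rTensor A
      ((Algebra.linearMap k A).lTensor A x)) (Coalgebra.sum_tmul_counit_eq r)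
    simp only [map_sum, LinearMap.rTensor_tmul, LinearMap.lTensor_tmul,
      Algebra.linearMap_apply, map_one] at h3
    rw [← h3]
    refine Finset.sum_congr rfl fun i _ => ?_
    rw [← Algebra.commutes, ← Algebra.smul_def, Algebra.algebraMap_eq_smul_one,
      TensorProduct.tmul_smul]
  rw [← h, ← h1, ← neg_sub, ← Finset.sum_sub_distrib]
  refine Submodule.neg_mem _ (Submodule.sum_mem _ fun i _ => ?_)
  rw [← mul_sub]
  exact Submodule.smul_mem _ _ (Submodule.subset_span ⟨_, rfl⟩)
end

section
/- The k-linear map φ : A ⊗_k A → A determined by a ⊗ b ↦ a·S(b) is surjective, satisfies φ((c⊗d)·u) = c·φ(u)·S(d) for all c, d ∈ A and u ∈ A ⊗_k A, and its kernel is exactly the underlying k-submodule of the left ideal W. Consequently φ induces a k-linear bijection (A ⊗_k A)/W → A, identifying the preantipode (A ⊗_k A)/W with the modulation of S as an (A, A^op)-bimodule, so that the modulation of the Hopf algebra A is a hopfish algebra. -/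
open TensorProduct

open Coalgebra HopfAlgebra in
lemma aux_left {k A : Type*} [CommRing k] [Ring A] [HopfAlgebra k A] (b : A) :
    ∑ i ∈ (ℛ k b).index, (antipode k ((ℛ k b).left i) ⊗ₜ[k] (1 : A)) *
      comul ((ℛ k b).right i) = 1 ⊗ₜ[k] b := by
  let T : A ⊗[k] (A ⊗[k] A) →ₗ[k] A ⊗[k] A :=
    (LinearMap.mul' k A).rTensor A ∘ₗ (TensorProduct.assoc k A A A).symm.toLinearMap ∘ₗ
      (antipode k (A := A)).rTensor (A ⊗[k] A)
  have h1 : ∀ (x : A) (w : A ⊗[k] A), T (x ⊗ₜ w) = (antipode k x ⊗ₜ[k] (1 : A)) * w := by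
    intro x w
    induction w using TensorProduct.induction_on with
    | zero => simp
    | tmul y z => simp [T]
    | add u v hu hv => rw [TensorProduct.tmul_add, map_add, hu, hv, mul_add]
  have h2 : ∀ (w : A ⊗[k] A) (z : A), T (TensorProduct.assoc k A A A (w ⊗ₜ z)) =
      LinearMap.mul' k A ((antipode k).rTensor A w) ⊗ₜ z := by
    intro w z
    induction w using TensorProduct.induction_on with
    | zero => simp
    | tmul y z => simp [T]
    | add u v hu hv => rw [TensorProduct.add_tmul, map_add, map_add, hu, hv, map_add, map_add,
        TensorProduct.add_tmul]
  have h := congrArg T (coassoc_apply (R := k) b)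
  rw [← (ℛ k b).eq] at h
  simp only [map_sum, LinearMap.rTensor_tmul, LinearMap.lTensor_tmul, h1, h2,
    mul_antipode_rTensor_comul_apply] at h
  rw [← h]
  simp only [Algebra.algebraMap_eq_smul_one, TensorProduct.smul_tmul, ← TensorProduct.tmul_sum,
    sum_counit_smul]

/-- For a Hopf algebra `A`, the `k`-linear map `φ : A ⊗ A → A`, `a ⊗ b ↦ a·S(b)`, is
surjective, satisfies `φ((c⊗d)·u) = c·φ(u)·S(d)`, and its kernel is exactly the left ideal
`W` generated by `{ε(a)·(1⊗1) − Δ(a)}`; hence `φ` identifies the preantipode `(A ⊗ A)/W`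
with the modulation of `S`, so the modulation of a Hopf algebra is hopfish. -/
theorem preantipode_iso_modulation_of_antipode
    {k A : Type*} [CommRing k] [Ring A] [HopfAlgebra k A]
    (φ : A ⊗[k] A →ₗ[k] A)
    (hφ : ∀ a b : A, φ (a ⊗ₜ[k] b) = a * HopfAlgebra.antipode (R := k) b) :
    Function.Surjective φ ∧
    (∀ (c d : A) (u : A ⊗[k] A),
      φ ((c ⊗ₜ[k] d) * u) = c * φ u * HopfAlgebra.antipode (R := k) d) ∧
    (∀ u : A ⊗[k] A, φ u = 0 ↔ u ∈
      Submodule.span (A ⊗[k] A)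
        {w : A ⊗[k] A | ∃ a : A,
          w = algebraMap k (A ⊗[k] A) (Coalgebra.counit a) - Coalgebra.comul a}) := by
  classical
  have hmul : ∀ (c d : A) (u : A ⊗[k] A),
      φ ((c ⊗ₜ[k] d) * u) = c * φ u * HopfAlgebra.antipode k d := by
    intro c d u
    induction u using TensorProduct.induction_on with
    | zero => simp
    | tmul y z => simp [hφ, HopfAlgebra.antipode_mul_antidistrib, mul_assoc]
    | add u v hu hv => rw [mul_add, map_add, hu, hv, map_add, mul_add, add_mul]
  have hΔ : ∀ a : A, φ (Coalgebra.comul a) = algebraMap k A (Coalgebra.counit a) := by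
    intro a
    rw [← HopfAlgebra.sum_mul_antipode_eq_algebraMap_counit (Coalgebra.Repr.arbitrary k a)]
    conv_lhs => rw [← (Coalgebra.Repr.arbitrary k a).eq]
    simp [hφ]
  have h0 : ∀ a : A, φ (algebraMap k (A ⊗[k] A) (Coalgebra.counit a) - Coalgebra.comul a) = 0 := by
    intro a
    rw [map_sub, hΔ, Algebra.algebraMap_eq_smul_one, map_smul, Algebra.TensorProduct.one_def, hφ,
      HopfAlgebra.antipode_one, mul_one, Algebra.algebraMap_eq_smul_one, sub_self]
  refine ⟨fun a => ⟨a ⊗ₜ 1, by simp [hφ]⟩, hmul, fun u => ⟨fun hu => ?_, fun hu => ?_⟩⟩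
  · set W := Submodule.span (A ⊗[k] A) {w : A ⊗[k] A | ∃ a : A,
          w = algebraMap k (A ⊗[k] A) (Coalgebra.counit a) - Coalgebra.comul a} with hW
    have key : ∀ v : A ⊗[k] A, φ v ⊗ₜ[k] (1 : A) - v ∈ W := by
      intro v
      induction v using TensorProduct.induction_on with
      | zero => simp
      | add u v hu hv =>
        rw [map_add, TensorProduct.add_tmul, add_sub_add_comm]
        exact W.add_mem hu hv
      | tmul a b =>
        have e : φ (a ⊗ₜ b) ⊗ₜ[k] (1 : A) - a ⊗ₜ b = ∑ i ∈ (Coalgebra.Repr.arbitrary k b).index,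
            ((a * HopfAlgebra.antipode k ((Coalgebra.Repr.arbitrary k b).left i)) ⊗ₜ[k] (1 : A)) •
            (algebraMap k (A ⊗[k] A) (Coalgebra.counit ((Coalgebra.Repr.arbitrary k b).right i)) - Coalgebra.comul ((Coalgebra.Repr.arbitrary k b).right i)) := by
          have e1 : a ⊗ₜ[k] b = (a ⊗ₜ[k] (1 : A)) * (1 ⊗ₜ[k] b) := by simp
          have e2 : HopfAlgebra.antipode k b = ∑ i ∈ (Coalgebra.Repr.arbitrary k b).index,
              Coalgebra.counit (R := k) ((Coalgebra.Repr.arbitrary k b).right i) • HopfAlgebra.antipode k ((Coalgebra.Repr.arbitrary k b).left i) := by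
            have := congrArg (TensorProduct.rid k A) (Coalgebra.sum_map_tmul_counit_eq (HopfAlgebra.antipode k) b
              (repr := Coalgebra.Repr.arbitrary k b))
            simpa only [map_sum, TensorProduct.rid_tmul, one_smul] using this.symm
          simp only [smul_eq_mul, mul_sub, Finset.sum_sub_distrib]
          congr 1
          · rw [hφ, e2, Finset.mul_sum, TensorProduct.sum_tmul]
            refine Finset.sum_congr rfl fun i _ => ?_
            rw [Algebra.algebraMap_eq_smul_one, mul_smul_comm, mul_smul_comm, mul_one,
              TensorProduct.smul_tmul']
          · rw [e1, ← aux_left (k := k) b, Finset.mul_sum]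
            refine Finset.sum_congr rfl fun i _ => ?_
            rw [← mul_assoc]; simp
        rw [e]
        exact W.sum_mem fun i _ => W.smul_mem _ (Submodule.subset_span ⟨_, rfl⟩)
    have := key u
    rw [hu, TensorProduct.zero_tmul, zero_sub] at this
    exact (W.neg_mem_iff).1 this
  · induction hu using Submodule.span_induction with
    | mem x hx => obtain ⟨a, rfl⟩ := hx; exact h0 a
    | zero => simp
    | add x y _ _ hx hy => rw [map_add, hx, hy, add_zero]
    | smul r x _ hx =>
      rw [smul_eq_mul]
      induction r using TensorProduct.induction_on with
      | zero => simp
      | tmul c d => rw [hmul, hx]; simp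
      | add u v hu hv => rw [add_mul, map_add, hu, hv, add_zero]
end

section
/- For every g ∈ G, the component e(g) of the unit is either 0 or 1. -/
/-- For a sesquiunital sesquialgebra structure of finite free type on `k^G` (encoded by
structure constants `d` and unit components `e` of an associative unital ring structure
on `ℤ^G` with nonnegative structure constants), each component `e(g)` of the unit is
either `0` or `1`. -/
theorem unit_component_zero_or_one {G : Type*} [Fintype G] [DecidableEq G]
    (d : G → G → G → ℕ) (e : G → ℕ)
    (hassoc : ∀ g h m t : G, ∑ s : G, d g h s * d s m t = ∑ s : G, d h m s * d g s t)
    (hunitL : ∀ g k : G, ∑ h : G, e h * d h g k = if g = k then 1 else 0)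
    (hunitR : ∀ g k : G, ∑ h : G, e h * d g h k = if g = k then 1 else 0) :
    ∀ g : G, e g = 0 ∨ e g = 1 := by
  intro g
  by_contra hcon
  push Not at hcon
  obtain ⟨h0, h1⟩ := hcon
  have hL := hunitL g g
  rw [if_pos rfl] at hL
  have hne : ∑ h : G, e h * d h g g ≠ 0 := by omega
  obtain ⟨h, -, hh⟩ := Finset.exists_ne_zero_of_sum_ne_zero hne
  have hd : d h g g ≠ 0 := fun hz => hh (by rw [hz, mul_zero])
  have hle : e g * d h g g ≤ ∑ x : G, e x * d h x g :=
    Finset.single_le_sum (f := fun x => e x * d h x g)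
      (fun _ _ => Nat.zero_le _) (Finset.mem_univ g)
  rw [hunitR h g] at hle
  have h2 : e g * 1 ≤ e g * d h g g := Nat.mul_le_mul_left _ (by omega)
  split_ifs at hle <;> omega
end

section
/- For every g ∈ G there exist unique elements l(g) and r(g) of G with e(l(g)) = 1 and e(r(g)) = 1 such that: for all h ∈ G with e(h) = 1 and all k ∈ G, d(h,g,k) = 1 if (h,k) = (l(g),g) and d(h,g,k) = 0 otherwise; and d(g,h,k) = 1 if (h,k) = (r(g),g) and d(g,h,k) = 0 otherwise. -/
theorem unit_aux {G : Type*} [Fintype G] [DecidableEq G] (e : G → ℕ) (g : G) (f : G → G → ℕ)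
    (H : ∀ k : G, ∑ h : G, e h * f h k = if g = k then 1 else 0) :
    ∃! lg : G, e lg = 1 ∧
        ∀ h : G, e h = 1 → ∀ k : G, f h k = if h = lg ∧ k = g then 1 else 0 := by
  have H1 : ∑ h : G, e h * f h g = 1 := by simpa using H g
  obtain ⟨l, -, hl⟩ : ∃ l ∈ Finset.univ, e l * f l g ≠ 0 :=
    Finset.exists_ne_zero_of_sum_ne_zero (by rw [H1]; exact one_ne_zero)
  have hle : e l * f l g ≤ 1 := by
    rw [← H1]
    exact Finset.single_le_sum (f := fun h => e h * f h g) (fun _ _ => Nat.zero_le _)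
      (Finset.mem_univ l)
  have hl1 : e l * f l g = 1 := by omega
  have hel : e l = 1 := Nat.eq_one_of_mul_eq_one_right hl1
  have hfl : f l g = 1 := Nat.eq_one_of_mul_eq_one_left hl1
  have hP : ∀ h : G, e h = 1 → ∀ k : G, f h k = if h = l ∧ k = g then 1 else 0 := by
    intro h he k
    by_cases hk : k = g
    · subst hk
      by_cases hh : h = l
      · subst hh; simp [hfl]
      · have := Finset.add_sum_erase Finset.univ (fun h => e h * f h k) (Finset.mem_univ l)
        simp only [H1, hl1] at this
        have h0 : ∑ x ∈ Finset.univ.erase l, e x * f x k = 0 := by omega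
        have := (Finset.sum_eq_zero_iff.mp h0) h (by simp [hh])
        simpa [he, hh] using this
    · have h0 := H k
      rw [if_neg (fun q => hk q.symm)] at h0
      have := (Finset.sum_eq_zero_iff.mp h0) h (Finset.mem_univ h)
      simpa [he, hk] using this
  refine ⟨l, ⟨hel, hP⟩, ?_⟩
  rintro y ⟨hey, hy⟩
  have h1 := hy y hey g
  have h2 := hP y hey g
  by_contra hne
  simp [hne] at h1 h2
  omega

/-- For every `g ∈ G` there are unique `l(g)` and `r(g)` in `G⁰ = {h : e h = 1}` such that
for all `h ∈ G⁰` and `k ∈ G`: `d(h,g,k) = 1` if `(h,k) = (l(g),g)` and `0` otherwise, and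
`d(g,h,k) = 1` if `(h,k) = (r(g),g)` and `0` otherwise. -/
theorem exists_unique_left_right_units {G : Type*} [Fintype G] [DecidableEq G]
    (d : G → G → G → ℕ) (e : G → ℕ)
    (hassoc : ∀ g h m t : G, ∑ s : G, d g h s * d s m t = ∑ s : G, d h m s * d g s t)
    (hunitL : ∀ g k : G, ∑ h : G, e h * d h g k = if g = k then 1 else 0)
    (hunitR : ∀ g k : G, ∑ h : G, e h * d g h k = if g = k then 1 else 0) :
    ∀ g : G,
      (∃! lg : G, e lg = 1 ∧
        ∀ h : G, e h = 1 → ∀ k : G, d h g k = if h = lg ∧ k = g then 1 else 0) ∧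
      (∃! rg : G, e rg = 1 ∧
        ∀ h : G, e h = 1 → ∀ k : G, d g h k = if h = rg ∧ k = g then 1 else 0) := by
  intro g
  exact ⟨unit_aux e g (fun h k => d h g k) (hunitL g), unit_aux e g (fun h k => d g h k) (hunitR g)⟩
end

section
/- The elements of G⁰ form a set of orthogonal idempotents in ℤ^G: for all g, h ∈ G with e(g) = 1 and e(h) = 1, and all k ∈ G, d(g,h,k) = 1 if g = h and k = g, and d(g,h,k) = 0 otherwise. -/
/-- The elements of `G⁰` form a set of orthogonal idempotents in `ℤ^G`: for `g, h ∈ G⁰`,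
`d(g,h,k) = 1` if `g = h ∧ k = g` and `0` otherwise. -/
theorem units_orthogonal_idempotents {G : Type*} [Fintype G] [DecidableEq G]
    (d : G → G → G → ℕ) (e : G → ℕ)
    (hassoc : ∀ g h m t : G, ∑ s : G, d g h s * d s m t = ∑ s : G, d h m s * d g s t)
    (hunitL : ∀ g k : G, ∑ h : G, e h * d h g k = if g = k then 1 else 0)
    (hunitR : ∀ g k : G, ∑ h : G, e h * d g h k = if g = k then 1 else 0) :
    ∀ g h : G, e g = 1 → e h = 1 → ∀ k : G, d g h k = if g = h ∧ k = g then 1 else 0 := by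
  have hL : ∀ g h k : G, e g = 1 → h ≠ k → d g h k = 0 := by
    intro g h k hg hne
    have h1 := hunitL h k
    rw [if_neg hne, Finset.sum_eq_zero_iff] at h1
    have h2 := h1 g (Finset.mem_univ g)
    rwa [hg, one_mul] at h2
  have hR : ∀ g h k : G, e h = 1 → g ≠ k → d g h k = 0 := by
    intro g h k hh hne
    have h1 := hunitR g k
    rw [if_neg hne, Finset.sum_eq_zero_iff] at h1
    have h2 := h1 h (Finset.mem_univ h)
    rwa [hh, one_mul] at h2
  intro g h hg hh k
  split_ifs with hc
  · obtain ⟨rfl, rfl⟩ := hc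
    have h1 := hunitL k k
    rw [if_pos rfl] at h1
    rw [Finset.sum_eq_single k] at h1
    · rwa [hg, one_mul] at h1
    · intro b _ hb
      rw [hR b k k hg hb, mul_zero]
    · intro hn
      exact absurd (Finset.mem_univ k) hn
  · by_cases h1 : g = k
    · by_cases h2 : h = k
      · exact absurd ⟨h1.trans h2.symm, h1.symm⟩ hc
      · exact hL g h k hg h2
    · exact hR g h k hh h1
end

section
/- For every g ∈ G there is exactly one s ∈ G with e(s) = 1 and d(g, σ(g), s) ≠ 0; for this s one has d(g, σ(g), s) = 1, and moreover s = l(g) = r(σ(g)). -/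
/-- In the presence of an antipode (encoded by `σ`): for every `g ∈ G` there is exactly one
`s ∈ G⁰` with `d(g,σ(g),s) ≠ 0`; for this `s` one has `d(g,σ(g),s) = 1` and
`s = l(g) = r(σ(g))`. -/
theorem exists_unique_inverse_unit {G : Type*} [Fintype G] [DecidableEq G]
    (d : G → G → G → ℕ) (e : G → ℕ)
    (hassoc : ∀ g h m t : G, ∑ s : G, d g h s * d s m t = ∑ s : G, d h m s * d g s t)
    (hunitL : ∀ g k : G, ∑ h : G, e h * d h g k = if g = k then 1 else 0)
    (hunitR : ∀ g k : G, ∑ h : G, e h * d g h k = if g = k then 1 else 0)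
    (l r : G → G)
    (hle : ∀ g : G, e (l g) = 1) (hre : ∀ g : G, e (r g) = 1)
    (hld : ∀ g h k : G, e h = 1 → d h g k = if h = l g ∧ k = g then 1 else 0)
    (hrd : ∀ g h k : G, e h = 1 → d g h k = if h = r g ∧ k = g then 1 else 0)
    (σ : G → G)
    (hσ : ∀ g h : G, (∑ t : G, e t * d g h t) = if h = σ g then 1 else 0) :
    ∀ g : G,
      (∃! s : G, e s = 1 ∧ d g (σ g) s ≠ 0) ∧
      (∀ s : G, e s = 1 → d g (σ g) s ≠ 0 →
        d g (σ g) s = 1 ∧ s = l g ∧ s = r (σ g)) := by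
  intro g
  have key : ∀ s : G, e s = 1 → d g (σ g) s ≠ 0 →
      d g (σ g) s = 1 ∧ s = l g ∧ s = r (σ g) := by
    intro s hs hd
    have h1 : e s * d g (σ g) s ≤ 1 := by
      have h := Finset.single_le_sum (f := fun t => e t * d g (σ g) t)
        (fun _ _ => Nat.zero_le _) (Finset.mem_univ s)
      simpa [hσ] using h
    rw [hs, one_mul] at h1
    have hls : s = l s := by
      have a := hld s (l s) s (hle s)
      have b := hrd (l s) s s hs
      rw [a] at b
      by_contra hne
      simp [hne] at b
    have hrs : s = r s := by
      have a := hrd s (r s) s (hre s)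
      have b := hld (r s) s s hs
      rw [a] at b
      by_contra hne
      simp [hne] at b
    refine ⟨by omega, ?_, ?_⟩
    · have h := hassoc (l g) g (σ g) s
      by_contra hne
      have hz : ∑ x : G, d g (σ g) x * d (l g) x s = 0 := by
        refine Finset.sum_eq_zero fun x _ => ?_
        rw [hld x (l g) s (hle g), if_neg, mul_zero]
        rintro ⟨h1, rfl⟩
        exact hne (hls.trans h1.symm)
      rw [hz, Finset.sum_eq_zero_iff] at h
      have h2 := h g (Finset.mem_univ g)
      rw [hld g (l g) g (hle g)] at h2
      simp at h2
      exact hd h2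
    · have h := hassoc g (σ g) (r (σ g)) s
      by_contra hne
      have hz : ∑ x : G, d g (σ g) x * d x (r (σ g)) s = 0 := by
        refine Finset.sum_eq_zero fun x _ => ?_
        rw [hrd x (r (σ g)) s (hre _), if_neg, mul_zero]
        rintro ⟨h1, rfl⟩
        exact hne (hrs.trans h1.symm)
      rw [hz] at h
      have h2 := (Finset.sum_eq_zero_iff.mp h.symm) (σ g) (Finset.mem_univ _)
      rw [hrd (σ g) (r (σ g)) (σ g) (hre _)] at h2
      simp at h2
      exact hd h2
  refine ⟨?_, key⟩
  have h := hσ g (σ g)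
  rw [if_pos rfl] at h
  obtain ⟨s, -, hs⟩ := Finset.exists_ne_zero_of_sum_ne_zero (h.symm ▸ one_ne_zero :
    (∑ t : G, e t * d g (σ g) t) ≠ 0)
  have h1 : e s * d g (σ g) s ≤ 1 := by
    have h' := Finset.single_le_sum (f := fun t => e t * d g (σ g) t)
      (fun _ _ => Nat.zero_le _) (Finset.mem_univ s)
    simpa [hσ] using h'
  have h2 : e s * d g (σ g) s = 1 := by omega
  obtain ⟨h3, h4⟩ := mul_eq_one.mp h2
  refine ⟨s, ⟨h3, by omega⟩, ?_⟩
  rintro y ⟨hy, hy'⟩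
  rw [(key y hy hy').2.1, ← (key s h3 (by omega)).2.1]
end

section
/- For all g, h ∈ G, if r(g) = l(h) then there exists s ∈ G such that d(g,h,s) ≠ 0. -/
/-- In the presence of an antipode: if `r(g) = l(h)` then the product of `g` and `h` is
nonzero, i.e. there exists `s` with `d(g,h,s) ≠ 0`. -/
theorem product_nonzero_of_composable {G : Type*} [Fintype G] [DecidableEq G]
    (d : G → G → G → ℕ) (e : G → ℕ)
    (hassoc : ∀ g h m t : G, ∑ s : G, d g h s * d s m t = ∑ s : G, d h m s * d g s t)
    (hunitL : ∀ g k : G, ∑ h : G, e h * d h g k = if g = k then 1 else 0)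
    (hunitR : ∀ g k : G, ∑ h : G, e h * d g h k = if g = k then 1 else 0)
    (l r : G → G)
    (hle : ∀ g : G, e (l g) = 1) (hre : ∀ g : G, e (r g) = 1)
    (hld : ∀ g h k : G, e h = 1 → d h g k = if h = l g ∧ k = g then 1 else 0)
    (hrd : ∀ g h k : G, e h = 1 → d g h k = if h = r g ∧ k = g then 1 else 0)
    (σ : G → G)
    (hσ : ∀ g h : G, (∑ t : G, e t * d g h t) = if h = σ g then 1 else 0) :
    ∀ g h : G, r g = l h → ∃ s : G, d g h s ≠ 0 := by
  intro g h hgh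
  by_contra! hz
  have h1 : ∑ t : G, e t * d h (σ h) t = 1 := by rw [hσ]; simp
  obtain ⟨t, ht⟩ : ∃ t : G, e t * d h (σ h) t ≠ 0 := by
    by_contra! hc
    simp [hc] at h1
  have hle1 : e t * d h (σ h) t ≤ 1 := by
    rw [← h1]
    exact Finset.single_le_sum (f := fun t => e t * d h (σ h) t)
      (fun _ _ => Nat.zero_le _) (Finset.mem_univ t)
  have hone : e t * d h (σ h) t = 1 := by omega
  have het : e t = 1 := Nat.eq_one_of_mul_eq_one_right hone
  have hdt : d h (σ h) t = 1 := Nat.eq_one_of_mul_eq_one_left hone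
  have hlt : l t = t := by
    have a := hld t (l t) t (hle t)
    have b := hrd (l t) t t het
    rw [a] at b
    by_contra hne
    have hne' : ¬ t = l t := fun h => hne h.symm
    simp [hne'] at b
  have hlh : l h = t := by
    have a := hassoc (l h) h (σ h) t
    have b : ∑ s : G, d (l h) h s * d s (σ h) t = 1 := by
      have : ∀ s, d (l h) h s = if s = h then 1 else 0 := by
        intro s; rw [hld h (l h) s (hle h)]; simp
      simp [this, hdt]
    rw [b] at a
    by_contra hne
    have c : ∀ s, d (l h) s t = 0 := by
      intro s
      rw [hld s (l h) t (hle h), if_neg]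
      rintro ⟨h1, rfl⟩
      exact hne (h1.trans hlt)
    simp [c] at a
  have a := hassoc g h (σ h) g
  simp only [hz, zero_mul, Finset.sum_const_zero] at a
  have c := (Finset.sum_eq_zero_iff.mp a.symm) t (Finset.mem_univ t)
  rw [hdt, ← hlh, ← hgh, hrd g (r g) g (hre g)] at c
  simp at c
end
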